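/- Araki–Lieb inequality: for any density operator ρ on a bipartite finite-dimensional Hilbert space H_A ⊗ H_B, |S(A) − S(B)| ≤ S(AB), where S denotes von Neumann entropy of the indicated reduced state. -/

import Mathlib

open scoped Kronecker ComplexOrder

/-- Von Neumann entropy (base-2) of a matrix, via eigenvalues of a Hermitian matrix. -/
noncomputable def vnEntropy {n : Type*} [Fintype n] [DecidableEq n] (ρ : Matrix n n ℂ) : ℝ :=
  if h : ρ.IsHermitian then -∑ i, h.eigenvalues i * Real.logb 2 (h.eigenvalues i) else 0

/-- Partial trace over the second tensor factor. -/
noncomputable def ptraceR {m k : Type*} [Fintype m] [Fintype k] (ρ : Matrix (m × k) (m × k) ℂ) :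
    Matrix m m ℂ :=
  Matrix.of fun i j => ∑ x, ρ (i, x) (j, x)

/-- Partial trace over the first tensor factor. -/
noncomputable def ptraceL {m k : Type*} [Fintype m] [Fintype k] (ρ : Matrix (m × k) (m × k) ℂ) :
    Matrix k k ℂ :=
  Matrix.of fun i j => ∑ x, ρ (x, i) (x, j)

/-- Quantum mutual information between the two tensor factors. -/
noncomputable def mutualInfo {m k : Type*} [Fintype m] [Fintype k] [DecidableEq m]
    [DecidableEq k] (ρ : Matrix (m × k) (m × k) ℂ) : ℝ :=
  vnEntropy (ptraceR ρ) + vnEntropy (ptraceL ρ) - vnEntropy ρ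

open Polynomial in
/-- Entropy read off from the roots of a polynomial (in nats). -/
noncomputable def polyEnt (p : ℂ[X]) : ℝ := (p.roots.map (fun z => Real.negMulLog z.re)).sum

lemma vnEntropy_eq_sum {n : Type*} [Fintype n] [DecidableEq n] {ρ : Matrix n n ℂ}
    (h : ρ.IsHermitian) :
    vnEntropy ρ = (∑ i, Real.negMulLog (h.eigenvalues i)) / Real.log 2 := by
  rw [vnEntropy, dif_pos h, ← Finset.sum_neg_distrib, Finset.sum_div]
  refine Finset.sum_congr rfl fun i _ => ?_
  simp only [Real.negMulLog, Real.logb]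
  ring

lemma vnEntropy_eq_polyEnt {n : Type*} [Fintype n] [DecidableEq n] {ρ : Matrix n n ℂ}
    (h : ρ.IsHermitian) : vnEntropy ρ = polyEnt ρ.charpoly / Real.log 2 := by
  rw [vnEntropy_eq_sum h, polyEnt, h.roots_charpoly_eq_eigenvalues]
  simp

lemma polyEnt_X_pow_mul (k : ℕ) (p : Polynomial ℂ) (hp : p ≠ 0) :
    polyEnt (Polynomial.X ^ k * p) = polyEnt p := by
  have h0 : (Polynomial.X ^ k * p : Polynomial ℂ) ≠ 0 :=
    mul_ne_zero (pow_ne_zero _ Polynomial.X_ne_zero) hp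
  rw [polyEnt, polyEnt, Polynomial.roots_mul h0, Polynomial.roots_X_pow]
  simp [Multiset.map_nsmul, Multiset.sum_nsmul]

lemma vnEntropy_mul_comm {m n : Type*} [Fintype m] [DecidableEq m] [Fintype n] [DecidableEq n]
    (M : Matrix m n ℂ) :
    vnEntropy (M * M.conjTranspose) = vnEntropy (M.conjTranspose * M).transpose := by
  have h1 : (M * M.conjTranspose).IsHermitian := Matrix.isHermitian_mul_conjTranspose_self M
  have h2 : (M.conjTranspose * M).IsHermitian := Matrix.isHermitian_conjTranspose_mul_self M
  rw [vnEntropy_eq_polyEnt h1, vnEntropy_eq_polyEnt h2.transpose, Matrix.charpoly_transpose]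
  have := Matrix.charpoly_mul_comm' M M.conjTranspose
  rw [← polyEnt_X_pow_mul (Fintype.card n) _ (Matrix.charpoly_monic _).ne_zero, this,
    polyEnt_X_pow_mul _ _ (Matrix.charpoly_monic _).ne_zero]

lemma ptraceR_conj {A B : Type*} [Fintype A] [Fintype B] [DecidableEq A] [DecidableEq B]
    (ρ : Matrix (A × B) (A × B) ℂ) (U : Matrix A A ℂ) (V : Matrix B B ℂ)
    (hV : V * V.conjTranspose = 1) :
    ptraceR ((U ⊗ₖ V).conjTranspose * ρ * (U ⊗ₖ V)) = U.conjTranspose * ptraceR ρ * U := by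
  ext i j
  have key : ∀ d c, ∑ x, V d x * star (V c x) = if d = c then 1 else 0 := by
    intro d c
    have := congrFun (congrFun hV d) c
    simpa [Matrix.mul_apply, Matrix.one_apply] using this
  simp only [ptraceR, Matrix.of_apply, Matrix.mul_apply, Matrix.conjTranspose_apply,
    Matrix.kroneckerMap_apply, star_mul', Finset.sum_mul, Finset.mul_sum]
  rw [Finset.sum_comm]
  rw [Fintype.sum_prod_type]
  refine Finset.sum_congr rfl fun b _ => ?_
  calc _ = ∑ d, ∑ a, ∑ c, star (U a i) * ρ (a, c) (b, d) * U b j *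
        ∑ x, V d x * star (V c x) := by
        refine Finset.sum_congr rfl fun d _ => ?_
        rw [Finset.sum_comm, Fintype.sum_prod_type]
        refine Finset.sum_congr rfl fun a _ => Finset.sum_congr rfl fun c _ => ?_
        rw [Finset.mul_sum]
        refine Finset.sum_congr rfl fun x _ => ?_
        ring
    _ = _ := by
        simp only [key]
        rw [Finset.sum_comm]
        simp

lemma ptraceL_conj {A B : Type*} [Fintype A] [Fintype B] [DecidableEq A] [DecidableEq B]
    (ρ : Matrix (A × B) (A × B) ℂ) (U : Matrix A A ℂ) (V : Matrix B B ℂ)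
    (hU : U * U.conjTranspose = 1) :
    ptraceL ((U ⊗ₖ V).conjTranspose * ρ * (U ⊗ₖ V)) = V.conjTranspose * ptraceL ρ * V := by
  have h := ptraceR_conj (ρ.submatrix Prod.swap Prod.swap) V U hU
  have e : ptraceR (ρ.submatrix Prod.swap Prod.swap) = ptraceL ρ := rfl
  rw [e] at h
  rw [← h]
  ext i j
  simp only [ptraceR, ptraceL, Matrix.of_apply]
  refine Finset.sum_congr rfl fun x _ => ?_
  simp only [Matrix.mul_apply, Matrix.conjTranspose_apply, Matrix.kroneckerMap_apply,
    Matrix.submatrix_apply]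
  rw [← (Equiv.prodComm A B).sum_comp]
  refine Finset.sum_congr rfl fun p _ => ?_
  rw [← (Equiv.prodComm A B).sum_comp]
  simp [mul_comm]

/-- Entropy is at most the Shannon entropy of the diagonal in any orthonormal basis. -/
lemma ent_le_diag {n : Type*} [Fintype n] [DecidableEq n] {ρ : Matrix n n ℂ}
    (h : ρ.PosSemidef) (W : Matrix n n ℂ) (hW : W * W.conjTranspose = 1) :
    ∑ i, Real.negMulLog (h.1.eigenvalues i) ≤
      ∑ x, Real.negMulLog ((W.conjTranspose * ρ * W) x x).re := by
  set Q : Matrix n n ℂ := (h.1.eigenvectorUnitary : Matrix n n ℂ) with hQ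
  have hQ1 : Q * Q.conjTranspose = 1 := by
    have := h.1.eigenvectorUnitary.2
    exact (Matrix.mem_unitaryGroup_iff).1 this
  have hQ2 : Q.conjTranspose * Q = 1 := mul_eq_one_comm.1 hQ1
  have hW2 : W.conjTranspose * W = 1 := mul_eq_one_comm.1 hW
  have hs : ρ = Q * Matrix.diagonal (fun i => (h.1.eigenvalues i : ℂ)) * Q.conjTranspose := by
    have := h.1.spectral_theorem
    rw [Unitary.conjStarAlgAut_apply] at this
    exact this
  set T := Q.conjTranspose * W with hT
  have hT1 : T * T.conjTranspose = 1 := by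
    rw [hT, Matrix.conjTranspose_mul, Matrix.conjTranspose_conjTranspose, Matrix.mul_assoc,
      ← Matrix.mul_assoc W, hW, Matrix.one_mul, hQ2]
  have hT2 : T.conjTranspose * T = 1 := mul_eq_one_comm.1 hT1
  have hd : ∀ x, ((W.conjTranspose * ρ * W) x x).re
      = ∑ y, Complex.normSq (T y x) * h.1.eigenvalues y := by
    intro x
    have : W.conjTranspose * ρ * W
        = T.conjTranspose * Matrix.diagonal (fun i => (h.1.eigenvalues i : ℂ)) * T := by
      conv_lhs => rw [hs]
      rw [hT, Matrix.conjTranspose_mul, Matrix.conjTranspose_conjTranspose]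
      simp only [Matrix.mul_assoc]
    rw [this, Matrix.mul_apply, Complex.re_sum]
    refine Finset.sum_congr rfl fun y _ => ?_
    rw [Matrix.mul_diagonal, Matrix.conjTranspose_apply]
    simp [Complex.normSq_apply]
    ring
  have hcol : ∀ x, ∑ y, Complex.normSq (T y x) = 1 := by
    intro x
    have := congrArg Complex.re (congrFun (congrFun hT2 x) x)
    rw [Matrix.mul_apply, Complex.re_sum] at this
    simpa [Complex.normSq_apply] using this
  have hrow : ∀ y, ∑ x, Complex.normSq (T y x) = 1 := by
    intro x
    have := congrArg Complex.re (congrFun (congrFun hT1 x) x)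
    rw [Matrix.mul_apply, Complex.re_sum] at this
    simpa [Complex.normSq_apply] using this
  calc ∑ i, Real.negMulLog (h.1.eigenvalues i)
      = ∑ y, ∑ x, Complex.normSq (T y x) * Real.negMulLog (h.1.eigenvalues y) := by
        refine Finset.sum_congr rfl fun y _ => ?_
        rw [← Finset.sum_mul, hrow, one_mul]
    _ = ∑ x, ∑ y, Complex.normSq (T y x) * Real.negMulLog (h.1.eigenvalues y) :=
        Finset.sum_comm
    _ ≤ _ := by
        refine Finset.sum_le_sum fun x _ => ?_
        rw [hd]
        have := Real.concaveOn_negMulLog.le_map_sum (t := Finset.univ)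
          (w := fun y => Complex.normSq (T y x)) (p := h.1.eigenvalues)
          (fun y _ => Complex.normSq_nonneg _) (hcol x)
          (fun y _ => h.eigenvalues_nonneg y)
        simpa [smul_eq_mul] using this

lemma classical_term (p q : ℝ) (hp : 0 ≤ p) (hq : 0 ≤ q) (h0 : q = 0 → p = 0) :
    Real.negMulLog p ≤ -(p * Real.log q) + q - p := by
  rcases hp.eq_or_lt with rfl | hp
  · simpa using hq
  have hq' : 0 < q := lt_of_le_of_ne hq fun h => hp.ne' (h0 h.symm)
  have h1 := Real.log_le_sub_one_of_pos (div_pos hq' hp)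
  rw [Real.log_div hq'.ne' hp.ne'] at h1
  have h2 := mul_le_mul_of_nonneg_left h1 hp.le
  have h3 : p * (q / p - 1) = q - p := by field_simp
  rw [h3] at h2
  rw [Real.negMulLog]
  linarith

lemma classical_subadd {A B : Type*} [Fintype A] [Fintype B] (p : A → B → ℝ)
    (hp : ∀ i j, 0 ≤ p i j) (h1 : ∑ i, ∑ j, p i j = 1) :
    ∑ i, ∑ j, Real.negMulLog (p i j) ≤
      ∑ i, Real.negMulLog (∑ j, p i j) + ∑ j, Real.negMulLog (∑ i, p i j) := by
  set a : A → ℝ := fun i => ∑ j, p i j with ha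
  set b : B → ℝ := fun j => ∑ i, p i j with hb
  have h1' : ∑ j, b j = 1 := by rw [← h1, Finset.sum_comm]
  have ha0 : ∀ i, 0 ≤ a i := fun i => Finset.sum_nonneg fun j _ => hp i j
  have hb0 : ∀ i, 0 ≤ b i := fun i => Finset.sum_nonneg fun j _ => hp j i
  have hpa : ∀ i j, p i j ≤ a i := fun i j =>
    Finset.single_le_sum (f := fun j => p i j) (fun j _ => hp i j) (Finset.mem_univ j)
  have hpb : ∀ i j, p i j ≤ b j := fun i j =>
    Finset.single_le_sum (f := fun i => p i j) (fun i _ => hp i j) (Finset.mem_univ i)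
  have term : ∀ i j, Real.negMulLog (p i j) ≤
      -(p i j * Real.log (a i)) + -(p i j * Real.log (b j)) + (a i * b j - p i j) := by
    intro i j
    have hz : a i * b j = 0 → p i j = 0 := by
      intro h
      rcases mul_eq_zero.1 h with h | h
      · exact le_antisymm (h ▸ hpa i j) (hp i j)
      · exact le_antisymm (h ▸ hpb i j) (hp i j)
    have := classical_term (p i j) (a i * b j) (hp i j) (mul_nonneg (ha0 i) (hb0 j)) hz
    by_cases hab : a i * b j = 0
    · rw [hz hab] at this ⊢
      simpa using this.trans (by simp)
    · rw [Real.log_mul (left_ne_zero_of_mul hab) (right_ne_zero_of_mul hab)] at this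
      linarith
  refine (Finset.sum_le_sum fun i _ => Finset.sum_le_sum fun j _ => term i j).trans ?_
  simp only [Finset.sum_add_distrib, Finset.sum_sub_distrib]
  have e1 : ∑ i, ∑ j, -(p i j * Real.log (a i)) = ∑ i, Real.negMulLog (a i) := by
    refine Finset.sum_congr rfl fun i _ => ?_
    rw [Finset.sum_neg_distrib, ← Finset.sum_mul, Real.negMulLog, neg_mul]
  have e2 : ∑ i, ∑ j, -(p i j * Real.log (b j)) = ∑ j, Real.negMulLog (b j) := by
    rw [Finset.sum_comm]
    refine Finset.sum_congr rfl fun i _ => ?_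
    rw [Finset.sum_neg_distrib, ← Finset.sum_mul, Real.negMulLog, neg_mul]
  have e3 : ∑ i, ∑ j, a i * b j = 1 := by
    rw [← Finset.sum_mul_sum, h1', h1, one_mul]
  rw [e1, e2, e3, h1]
  simp [ha, hb]

lemma ptraceR_herm {A B : Type*} [Fintype A] [Fintype B]
    {ρ : Matrix (A × B) (A × B) ℂ} (h : ρ.IsHermitian) : (ptraceR ρ).IsHermitian := by
  ext i j
  simp only [ptraceR, Matrix.conjTranspose_apply, Matrix.of_apply, star_sum]
  exact Finset.sum_congr rfl fun x _ => h.apply _ _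

lemma ptraceL_herm {A B : Type*} [Fintype A] [Fintype B]
    {ρ : Matrix (A × B) (A × B) ℂ} (h : ρ.IsHermitian) : (ptraceL ρ).IsHermitian := by
  ext i j
  simp only [ptraceL, Matrix.conjTranspose_apply, Matrix.of_apply, star_sum]
  exact Finset.sum_congr rfl fun x _ => h.apply _ _

lemma diag_eig {n : Type*} [Fintype n] [DecidableEq n] {ρ : Matrix n n ℂ}
    (h : ρ.IsHermitian) (i : n) :
    (((h.eigenvectorUnitary : Matrix n n ℂ).conjTranspose * ρ *
      (h.eigenvectorUnitary : Matrix n n ℂ)) i i).re = h.eigenvalues i := by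
  set Q : Matrix n n ℂ := (h.eigenvectorUnitary : Matrix n n ℂ) with hQ
  have hQ1 : Q * Q.conjTranspose = 1 := (Matrix.mem_unitaryGroup_iff).1 h.eigenvectorUnitary.2
  have hQ2 : Q.conjTranspose * Q = 1 := mul_eq_one_comm.1 hQ1
  have hs : ρ = Q * Matrix.diagonal (fun i => (h.eigenvalues i : ℂ)) * Q.conjTranspose := by
    have := h.spectral_theorem
    rw [Unitary.conjStarAlgAut_apply] at this
    exact this
  have : Q.conjTranspose * ρ * Q = Matrix.diagonal (fun i => (h.eigenvalues i : ℂ)) := by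
    conv_lhs => rw [hs]
    rw [← Matrix.mul_assoc, ← Matrix.mul_assoc, hQ2, Matrix.one_mul, Matrix.mul_assoc, hQ2,
      Matrix.mul_one]
  rw [this]
  simp

lemma subadd {A B : Type*} [Fintype A] [Fintype B] [DecidableEq A] [DecidableEq B]
    (ρ : Matrix (A × B) (A × B) ℂ) (hpos : ρ.PosSemidef) (htr : ρ.trace = 1) :
    vnEntropy ρ ≤ vnEntropy (ptraceR ρ) + vnEntropy (ptraceL ρ) := by
  have hA := ptraceR_herm hpos.1
  have hB := ptraceL_herm hpos.1
  rw [vnEntropy_eq_sum hpos.1, vnEntropy_eq_sum hA, vnEntropy_eq_sum hB, ← add_div]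
  refine div_le_div_of_nonneg_right ?_ (Real.log_nonneg (by norm_num))
  set U : Matrix A A ℂ := (hA.eigenvectorUnitary : Matrix A A ℂ) with hU
  set V : Matrix B B ℂ := (hB.eigenvectorUnitary : Matrix B B ℂ) with hV
  have hU1 : U * U.conjTranspose = 1 := (Matrix.mem_unitaryGroup_iff).1 hA.eigenvectorUnitary.2
  have hV1 : V * V.conjTranspose = 1 := (Matrix.mem_unitaryGroup_iff).1 hB.eigenvectorUnitary.2
  have hW : (U ⊗ₖ V) * (U ⊗ₖ V).conjTranspose = 1 := by
    rw [Matrix.conjTranspose_kronecker, ← Matrix.mul_kronecker_mul, hU1, hV1,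
      Matrix.one_kronecker_one]
  set σ := (U ⊗ₖ V).conjTranspose * ρ * (U ⊗ₖ V) with hσ
  have hσp : σ.PosSemidef := hpos.conjTranspose_mul_mul_same _
  have hσt : σ.trace = 1 := by
    rw [hσ, Matrix.trace_mul_comm, ← Matrix.mul_assoc, hW, Matrix.one_mul, htr]
  have hmA : ∀ i, ∑ j, (σ (i, j) (i, j)).re = hA.eigenvalues i := by
    intro i
    rw [← diag_eig hA i, ← hU, ← ptraceR_conj ρ U V hV1, ← hσ]
    simp [ptraceR]
  have hmB : ∀ j, ∑ i, (σ (i, j) (i, j)).re = hB.eigenvalues j := by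
    intro i
    rw [← diag_eig hB i, ← hV, ← ptraceL_conj ρ U V hU1, ← hσ]
    simp [ptraceL]
  refine (ent_le_diag hpos _ hW).trans ?_
  rw [← hσ, Fintype.sum_prod_type]
  refine (classical_subadd (fun i j => (σ (i, j) (i, j)).re) ?_ ?_).trans ?_
  · intro i j
    exact (Complex.le_def.1 (hσp.diag_nonneg (i := (i, j)))).1
  · have := congrArg Complex.re hσt
    rw [Matrix.trace, Complex.re_sum, Fintype.sum_prod_type] at this
    simpa using this
  · simp only [hmA, hmB]
    exact le_rfl

lemma half {A B : Type*} [Fintype A] [Fintype B] [DecidableEq A] [DecidableEq B]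
    (ρ : Matrix (A × B) (A × B) ℂ) (hpos : ρ.PosSemidef) (htr : ρ.trace = 1) :
    vnEntropy (ptraceL ρ) ≤ vnEntropy (ptraceR ρ) + vnEntropy ρ := by
  obtain ⟨K, hK⟩ : ∃ K : Matrix (A × B) (A × B) ℂ, ρ = K * K.conjTranspose := by
    set Q : Matrix (A × B) (A × B) ℂ := hpos.1.eigenvectorUnitary.1 with hQ
    have hs : ρ = Q * Matrix.diagonal (fun i => (hpos.1.eigenvalues i : ℂ)) *
        Q.conjTranspose := by
      have := hpos.1.spectral_theorem
      rw [Unitary.conjStarAlgAut_apply] at this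
      exact this
    refine ⟨Q * Matrix.diagonal (fun i => ((Real.sqrt (hpos.1.eigenvalues i) : ℝ) : ℂ)), ?_⟩
    rw [Matrix.conjTranspose_mul, Matrix.diagonal_conjTranspose, Matrix.mul_assoc,
      ← Matrix.mul_assoc (Matrix.diagonal _), Matrix.diagonal_mul_diagonal, ← Matrix.mul_assoc]
    refine hs.trans ?_
    congr 3
    funext i
    simp only [Pi.star_apply, Complex.star_def, Complex.conj_ofReal, ← Complex.ofReal_mul]
    rw [Real.mul_self_sqrt (hpos.eigenvalues_nonneg i)]
  let N : Matrix (A × (A × B)) B ℂ := Matrix.of fun p b => K (p.1, b) p.2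
  have hN : (N * N.conjTranspose).PosSemidef := Matrix.posSemidef_self_mul_conjTranspose N
  have eR : ptraceR (N * N.conjTranspose) = ptraceR ρ := by
    ext i j
    simp only [ptraceR, hK, Matrix.of_apply, Matrix.mul_apply, Matrix.conjTranspose_apply, N]
    exact Finset.sum_comm
  have eL : ptraceL (N * N.conjTranspose) = (K.conjTranspose * K).transpose := by
    ext i j
    simp only [ptraceL, Matrix.of_apply, Matrix.mul_apply, Matrix.conjTranspose_apply, N,
      Matrix.transpose_apply, Fintype.sum_prod_type, mul_comm]
  have eB : (N.conjTranspose * N).transpose = ptraceL ρ := by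
    ext i j
    simp only [ptraceL, hK, Matrix.of_apply, Matrix.mul_apply, Matrix.conjTranspose_apply, N,
      Matrix.transpose_apply]
    rw [Fintype.sum_prod_type]
    simp only [mul_comm]
  have hNt : (N * N.conjTranspose).trace = 1 := by
    have e : ∀ {X Y : Type _} [Fintype X] [Fintype Y] (τ : Matrix (X × Y) (X × Y) ℂ),
        τ.trace = (ptraceR τ).trace := by
      intro X Y _ _ τ
      simp [Matrix.trace, ptraceR, Fintype.sum_prod_type]
    have e2 : (ptraceR ρ).trace = ρ.trace := by
      simp [Matrix.trace, ptraceR, Fintype.sum_prod_type]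
    rw [e, eR, e2, htr]
  have := subadd _ hN hNt
  rw [eR, eL, ← vnEntropy_mul_comm K, ← hK, vnEntropy_mul_comm N, eB] at this
  exact this

/-- Araki–Lieb inequality: |S(A) − S(B)| ≤ S(AB). -/
theorem stmt_2 {A B : Type*} [Fintype A] [Fintype B] [DecidableEq A] [DecidableEq B]
    (ρ : Matrix (A × B) (A × B) ℂ) (hpos : ρ.PosSemidef) (htr : ρ.trace = 1) :
    |vnEntropy (ptraceR ρ) - vnEntropy (ptraceL ρ)| ≤ vnEntropy ρ := by
  have h1 := half ρ hpos htr
  have hp2 : (ρ.submatrix Prod.swap Prod.swap : Matrix (B × A) (B × A) ℂ).PosSemidef :=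
    hpos.submatrix _
  have h2 := half (ρ.submatrix Prod.swap Prod.swap : Matrix (B × A) (B × A) ℂ) hp2 (by
    rw [← htr, Matrix.trace, Matrix.trace, ← (Equiv.prodComm A B).sum_comp]
    simp)
  have e1 : ptraceR (ρ.submatrix Prod.swap Prod.swap) = ptraceL ρ := rfl
  have e2 : ptraceL (ρ.submatrix Prod.swap Prod.swap) = ptraceR ρ := rfl
  have e3 : vnEntropy (ρ.submatrix Prod.swap Prod.swap : Matrix (B × A) (B × A) ℂ)
      = vnEntropy ρ := by
    rw [vnEntropy_eq_polyEnt hp2.1, vnEntropy_eq_polyEnt hpos.1,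
      ← Matrix.charpoly_reindex (Equiv.prodComm A B) ρ]
    rfl
  rw [e1, e2, e3] at h2
  rw [abs_le]
  constructor <;> linarith
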